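/- arXiv:2009.01512 — 5 statements merged into one kernel-verified Lean document; each statement's English description precedes it below -/
import Mathlib

section
/- Let P be a finite set of points in Euclidean space ℝ^d. For every δ ≥ 0 and all p, q ∈ P, the points p and q lie in the same connected component of the δ-threshold graph on P if and only if p and q are joined by a path in the simple graph on P whose edges are the topology-changing edges {a,b} of P with dist(a,b) ≤ δ. -/
open scoped Classical

/-- The `δ`-threshold graph on a finite point set `P` in a metric space:
vertices are the points of `P`, with an edge between distinct points
`p, q` exactly when `dist p q ≤ δ`. -/
def threshGraph {X : Type*} [MetricSpace X] (P : Finset X) (δ : ℝ) : SimpleGraph P :=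
  SimpleGraph.fromRel (fun p q => dist (p : X) (q : X) ≤ δ)

/-- The strict sub-threshold graph on `P`: an edge between distinct points
`p, q` exactly when `dist p q < ℓ`. -/
def strictGraph {X : Type*} [MetricSpace X] (P : Finset X) (ℓ : ℝ) : SimpleGraph P :=
  SimpleGraph.fromRel (fun p q => dist (p : X) (q : X) < ℓ)

/-- `{p, q}` is a topology-changing edge of `P` if `p ≠ q` and `p` and `q` lie in
different connected components of the graph on `P` whose edges are the pairs of
distinct points at distance strictly less than `dist p q`. -/
def IsTopoEdge {X : Type*} [MetricSpace X] (P : Finset X) (p q : P) : Prop :=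
  p ≠ q ∧ ¬ (strictGraph P (dist (p : X) (q : X))).Reachable p q

/-- The simple graph on `P` whose edges are exactly the topology-changing edges of `P`. -/
def topoGraph {X : Type*} [MetricSpace X] (P : Finset X) : SimpleGraph P :=
  SimpleGraph.fromRel (fun p q => IsTopoEdge P p q)

/-- `P` is in general position: the distances over all unordered pairs of distinct
points of `P` are pairwise distinct. -/
def GenPos {X : Type*} [MetricSpace X] (P : Finset X) : Prop :=
  ∀ p q r s : P, p ≠ q → r ≠ s → dist (p : X) (q : X) = dist (r : X) (s : X) →
    (p = r ∧ q = s) ∨ (p = s ∧ q = r)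

/-- The length (Euclidean distance between the endpoints) of an unordered pair of
points of `P`. -/
noncomputable def edgeLen {X : Type*} [MetricSpace X] (P : Finset X) : Sym2 P → ℝ :=
  Sym2.lift ⟨fun p q => dist (p : X) (q : X), fun _ _ => dist_comm _ _⟩


/-- For every `δ ≥ 0` and all `p, q ∈ P`, the points `p` and `q` lie
in the same connected component of the `δ`-threshold graph on `P` iff they are joined
by a path in the graph on `P` whose edges are the topology-changing edges of `P` of
length at most `δ`. -/
theorem thresh_reachable_iff_topo {d : ℕ} (P : Finset (EuclideanSpace ℝ (Fin d))) :
    ∀ δ : ℝ, 0 ≤ δ → ∀ p q : P,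
      (threshGraph P δ).Reachable p q ↔
      (SimpleGraph.fromRel (fun a b : P =>
        IsTopoEdge P a b ∧
          dist (a : EuclideanSpace ℝ (Fin d)) (b : EuclideanSpace ℝ (Fin d)) ≤ δ)).Reachable
        p q := by
  intro δ _ p q
  have key : ∀ x : P × P, dist (x.1 : EuclideanSpace ℝ (Fin d)) x.2 ≤ δ →
      (SimpleGraph.fromRel (fun a b : P =>
        IsTopoEdge P a b ∧
          dist (a : EuclideanSpace ℝ (Fin d)) (b : EuclideanSpace ℝ (Fin d)) ≤ δ)).Reachable
        x.1 x.2 := by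
    have wf : WellFounded (fun x y : P × P =>
        dist (x.1 : EuclideanSpace ℝ (Fin d)) x.2 < dist (y.1 : EuclideanSpace ℝ (Fin d)) y.2) := by
      have : IsTrans (P × P) (fun x y : P × P =>
        dist (x.1 : EuclideanSpace ℝ (Fin d)) x.2 < dist (y.1 : EuclideanSpace ℝ (Fin d)) y.2) :=
        ⟨fun _ _ _ h k => lt_trans h k⟩
      have : Std.Irrefl (fun x y : P × P =>
        dist (x.1 : EuclideanSpace ℝ (Fin d)) x.2 < dist (y.1 : EuclideanSpace ℝ (Fin d)) y.2) :=
        ⟨fun _ h => lt_irrefl _ h⟩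
      exact Finite.wellFounded_of_trans_of_irrefl _
    intro x
    induction x using wf.induction with
    | _ x ih =>
    obtain ⟨a, b⟩ := x
    intro hab
    by_cases hne : a = b
    · subst hne
      exact SimpleGraph.Reachable.refl _
    by_cases hr : (strictGraph P (dist (a : EuclideanSpace ℝ (Fin d)) b)).Reachable a b
    · rw [SimpleGraph.reachable_iff_reflTransGen] at hr
      have step : ∀ c : P, Relation.ReflTransGen
          (strictGraph P (dist (a : EuclideanSpace ℝ (Fin d)) b)).Adj a c →
          (SimpleGraph.fromRel (fun a b : P =>
            IsTopoEdge P a b ∧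
              dist (a : EuclideanSpace ℝ (Fin d)) (b : EuclideanSpace ℝ (Fin d)) ≤ δ)).Reachable
            a c := by
        intro c hc
        induction hc with
        | refl => exact SimpleGraph.Reachable.refl _
        | @tail u v _ huv ih2 =>
          refine ih2.trans ?_
          have hlt : dist (u : EuclideanSpace ℝ (Fin d)) v
              < dist (a : EuclideanSpace ℝ (Fin d)) b := by
            rw [strictGraph, SimpleGraph.fromRel_adj] at huv
            rcases huv.2 with h | h
            · exact h
            · rwa [dist_comm]
          exact ih (u, v) hlt (hlt.le.trans hab)
      exact step b hr
    · apply SimpleGraph.Adj.reachable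
      rw [SimpleGraph.fromRel_adj]
      exact ⟨hne, Or.inl ⟨⟨hne, hr⟩, hab⟩⟩
  constructor
  · intro h
    rw [SimpleGraph.reachable_iff_reflTransGen] at h
    induction h with
    | refl => exact SimpleGraph.Reachable.refl _
    | @tail u v _ huv ih =>
      refine ih.trans (key (u, v) ?_)
      rw [threshGraph, SimpleGraph.fromRel_adj] at huv
      rcases huv.2 with h | h
      · exact h
      · rwa [dist_comm]
  · intro h
    refine h.mono ?_
    intro a b hab
    rw [SimpleGraph.fromRel_adj] at hab
    rw [threshGraph, SimpleGraph.fromRel_adj]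
    exact ⟨hab.1, hab.2.imp (fun h => h.2) (fun h => h.2)⟩
end

section
/- Let P be a finite set of points in Euclidean space ℝ^d that is in general position, and let T be the simple graph on vertex set P whose edges are exactly the topology-changing edges of P (T is a tree). Then for all distinct p, q ∈ P, the least δ ≥ 0 such that p and q lie in the same connected component of the δ-threshold graph on P equals the maximum of dist(a,b) over the edges {a,b} of the unique path in T from p to q. -/
open scoped Classical

theorem reach_of_path {V : Type*} {G H : SimpleGraph V} {e : Sym2 V} {a b : V} (he : e = s(a, b)) :
    ∀ {p q : V} (W : G.Walk p q), W.edges.Nodup → e ∈ W.edges →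
      (∀ f ∈ W.edges, f ≠ e → f ∈ H.edgeSet) → H.Reachable p q → H.Reachable a b := by
  intro p q W
  induction W with
  | nil => intro _ h; simp at h
  | @cons u v w h W ih =>
    intro hn hm hH hr
    rw [SimpleGraph.Walk.edges_cons, List.nodup_cons] at hn
    rw [SimpleGraph.Walk.edges_cons] at hm hH
    by_cases hf : s(u, v) = e
    · have hvw : H.Reachable v w := ⟨W.transfer H (fun f hfW =>
        hH f (List.mem_cons_of_mem _ hfW) (fun h' => hn.1 (by rw [hf, ← h']; exact hfW)))⟩
      have huv : H.Reachable u v := hr.trans hvw.symm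
      rw [he, Sym2.eq_iff] at hf
      rcases hf with ⟨rfl, rfl⟩ | ⟨rfl, rfl⟩
      · exact huv
      · exact huv.symm
    · have hadj : H.Adj u v := hH _ List.mem_cons_self hf
      refine ih hn.2 ?_ (fun f hfW => hH f (List.mem_cons_of_mem _ hfW)) (hadj.symm.reachable.trans hr)
      rcases List.mem_cons.1 hm with h' | h'
      · exact absurd h'.symm hf
      · exact h'

theorem topo_adj {X : Type*} [MetricSpace X] {P : Finset X} {a b : P}
    (h : (topoGraph P).Adj a b) :
    a ≠ b ∧ ¬ (strictGraph P (dist (a : X) (b : X))).Reachable a b := by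
  rw [topoGraph, SimpleGraph.fromRel_adj] at h
  refine ⟨h.1, ?_⟩
  rcases h.2 with h' | h'
  · exact h'.2
  · intro hr
    apply h'.2
    rw [dist_comm]
    exact hr.symm

/-- For `P` in general position and distinct `p, q ∈ P`, the least
`δ ≥ 0` such that `p` and `q` lie in the same connected component of the
`δ`-threshold graph on `P` equals the maximum edge length along the (unique) path
from `p` to `q` in the tree of topology-changing edges of `P`. -/
theorem merge_threshold_eq_path_max {d : ℕ} (P : Finset (EuclideanSpace ℝ (Fin d)))
    (hgp : GenPos P) (p q : P) (hpq : p ≠ q)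
    (W : (topoGraph P).Walk p q) (hW : W.IsPath) :
    (W.edges.map (edgeLen P)).maximum =
      (sInf {δ : ℝ | 0 ≤ δ ∧ (threshGraph P δ).Reachable p q} : ℝ) := by
  set L := W.edges.map (edgeLen P) with hL
  have hne : L ≠ [] := by
    cases W with
    | nil => exact absurd rfl hpq
    | cons h W => simp [hL]
  obtain ⟨m, hm⟩ := WithBot.ne_bot_iff_exists.1 (List.maximum_ne_bot_of_ne_nil hne)
  rw [← hm, WithBot.coe_inj]
  have hmem : m ∈ L := List.maximum_mem hm.symm
  have hle : ∀ x ∈ L, x ≤ m := fun x hx => List.le_maximum_of_mem hx hm.symm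
  obtain ⟨e, heW, hem⟩ := List.mem_map.1 hmem
  induction e using Sym2.ind with
  | _ a b =>
  have hab : dist (a : EuclideanSpace ℝ (Fin d)) b = m := hem
  obtain ⟨hne_ab, hnr⟩ := topo_adj (W.adj_of_mem_edges heW)
  symm
  apply IsLeast.csInf_eq
  refine ⟨⟨hab ▸ dist_nonneg, ⟨W.transfer _ ?_⟩⟩, ?_⟩
  · intro f hf
    induction f using Sym2.ind with
    | _ x y =>
    rw [SimpleGraph.mem_edgeSet, threshGraph, SimpleGraph.fromRel_adj]
    exact ⟨(W.adj_of_mem_edges hf).ne, Or.inl (hle _ (List.mem_map_of_mem (f := edgeLen P) hf))⟩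
  · rintro δ ⟨-, hδ⟩
    by_contra hlt
    rw [not_le] at hlt
    apply hnr
    refine reach_of_path rfl W hW.isTrail.edges_nodup heW ?_ (hδ.mono ?_)
    · intro f hf hfe
      induction f using Sym2.ind with
      | _ x y =>
      have hxy := (W.adj_of_mem_edges hf).ne
      rw [SimpleGraph.mem_edgeSet, strictGraph, SimpleGraph.fromRel_adj]
      refine ⟨hxy, Or.inl (lt_of_le_of_ne ?_ ?_)⟩
      · rw [hab]
        exact hle _ (List.mem_map_of_mem (f := edgeLen P) hf)
      · intro h
        exact hfe (Sym2.eq_iff.2 (hgp _ _ _ _ hxy hne_ab h))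
    · intro x y hxy
      rw [threshGraph, SimpleGraph.fromRel_adj] at hxy
      rw [strictGraph, SimpleGraph.fromRel_adj, hab]
      exact ⟨hxy.1, hxy.2.imp (fun h => h.trans_lt hlt) (fun h => h.trans_lt hlt)⟩
end

section
/- Let P be a finite set of n points in Euclidean space ℝ^d that is in general position. Then for every δ ≥ 0, the number of connected components of the δ-threshold graph on P equals n minus the number of topology-changing edges {p,q} of P with dist(p,q) ≤ δ. -/
open scoped Classical

namespace CompCount

variable {V : Type*}

theorem reach_sup {G : SimpleGraph V} {u v a b : V}
    (h : (G ⊔ SimpleGraph.edge u v).Reachable a b) :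
    G.Reachable a b ∨ (G.Reachable a u ∧ G.Reachable v b) ∨
      (G.Reachable a v ∧ G.Reachable u b) := by
  obtain ⟨w⟩ := h
  induction w with
  | nil => exact Or.inl (SimpleGraph.Reachable.refl _)
  | @cons x y z hxy p ih =>
    rw [SimpleGraph.sup_adj, SimpleGraph.edge_adj] at hxy
    rcases hxy with hxy | ⟨⟨rfl, rfl⟩ | ⟨rfl, rfl⟩, hne⟩
    · have hr := hxy.reachable
      rcases ih with h | ⟨h1, h2⟩ | ⟨h1, h2⟩
      · exact Or.inl (hr.trans h)
      · exact Or.inr (Or.inl ⟨hr.trans h1, h2⟩)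
      · exact Or.inr (Or.inr ⟨hr.trans h1, h2⟩)
    · rcases ih with h | ⟨h1, h2⟩ | ⟨h1, h2⟩
      · exact Or.inr (Or.inl ⟨.refl _, h⟩)
      · exact Or.inr (Or.inl ⟨.refl _, h2⟩)
      · exact Or.inl h2
    · rcases ih with h | ⟨h1, h2⟩ | ⟨h1, h2⟩
      · exact Or.inr (Or.inr ⟨.refl _, h⟩)
      · exact Or.inl h2
      · exact Or.inr (Or.inr ⟨.refl _, h2⟩)

theorem card_sup_of_reachable [Finite V] {G : SimpleGraph V} {u v : V}
    (h : G.Reachable u v) :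
    Nat.card (G ⊔ SimpleGraph.edge u v).ConnectedComponent = Nat.card G.ConnectedComponent := by
  symm
  refine Nat.card_eq_of_bijective (SimpleGraph.ConnectedComponent.map
    (SimpleGraph.Hom.ofLE (le_sup_left : G ≤ G ⊔ SimpleGraph.edge u v))) ⟨?_, ?_⟩
  · intro c d
    induction c using SimpleGraph.ConnectedComponent.ind with | h a
    induction d using SimpleGraph.ConnectedComponent.ind with | h b
    intro hcd
    have hcd := SimpleGraph.ConnectedComponent.exact hcd
    apply SimpleGraph.ConnectedComponent.sound
    rcases reach_sup hcd with h' | ⟨h1, h2⟩ | ⟨h1, h2⟩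
    · exact h'
    · exact h1.trans (h.trans h2)
    · exact h1.trans (h.symm.trans h2)
  · exact SimpleGraph.ConnectedComponent.surjective_map_ofLE le_sup_left

theorem card_sup_of_not_reachable [Finite V] {G : SimpleGraph V} {u v : V}
    (h : ¬ G.Reachable u v) :
    Nat.card (G ⊔ SimpleGraph.edge u v).ConnectedComponent + 1
      = Nat.card G.ConnectedComponent := by
  have huv : u ≠ v := by rintro rfl; exact h (.refl _)
  have hb : Nat.card {c : G.ConnectedComponent // c ≠ G.connectedComponentMk v} =
      Nat.card (G ⊔ SimpleGraph.edge u v).ConnectedComponent := by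
    refine Nat.card_eq_of_bijective (fun c => SimpleGraph.ConnectedComponent.map
      (SimpleGraph.Hom.ofLE (le_sup_left : G ≤ G ⊔ SimpleGraph.edge u v)) c.1) ⟨?_, ?_⟩
    · rintro ⟨c, hc⟩ ⟨d, hd⟩
      induction c using SimpleGraph.ConnectedComponent.ind with | h a
      induction d using SimpleGraph.ConnectedComponent.ind with | h b
      intro hcd
      have hcd := SimpleGraph.ConnectedComponent.exact hcd
      apply Subtype.ext
      apply SimpleGraph.ConnectedComponent.sound
      rcases reach_sup hcd with h' | ⟨h1, h2⟩ | ⟨h1, h2⟩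
      · exact h'
      · exact absurd (SimpleGraph.ConnectedComponent.sound h2.symm) hd
      · exact absurd (SimpleGraph.ConnectedComponent.sound h1) hc
    · intro c
      induction c using SimpleGraph.ConnectedComponent.ind with | h a
      by_cases ha : G.connectedComponentMk a = G.connectedComponentMk v
      · refine ⟨⟨G.connectedComponentMk u, fun h' =>
          h (SimpleGraph.ConnectedComponent.exact h')⟩, ?_⟩
        apply SimpleGraph.ConnectedComponent.sound
        have h1 : (G ⊔ SimpleGraph.edge u v).Adj u v := by
          simp [SimpleGraph.edge_adj, huv]
        exact h1.reachable.trans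
          ((SimpleGraph.ConnectedComponent.exact ha).mono le_sup_left).symm
      · exact ⟨⟨_, ha⟩, rfl⟩
  rw [← hb]
  have := Fintype.ofFinite G.ConnectedComponent
  have := Fintype.card_subtype_compl (fun c => c = G.connectedComponentMk v)
  rw [Fintype.card_subtype_eq] at this
  have hpos : 0 < Fintype.card G.ConnectedComponent :=
    Fintype.card_pos_iff.mpr ⟨G.connectedComponentMk v⟩
  rw [Nat.card_eq_fintype_card, Nat.card_eq_fintype_card]
  simp only [ne_eq]
  omega

/-- The endpoints of `e` are not joined in `G`. -/
def Sep (G : SimpleGraph V) (e : Sym2 V) : Prop :=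
  ∀ u v, e = s(u, v) → ¬ G.Reachable u v

theorem sep_mk {G : SimpleGraph V} {u v : V} : Sep G s(u, v) ↔ ¬ G.Reachable u v := by
  refine ⟨fun h => h u v rfl, fun h a b hab => ?_⟩
  rcases Sym2.eq_iff.mp hab with ⟨rfl, rfl⟩ | ⟨rfl, rfl⟩
  · exact h
  · exact fun h' => h h'.symm

theorem kruskal [Finite V] (w : Sym2 V → ℝ) (S : Finset (Sym2 V)) (hinj : Set.InjOn w S) :
    Nat.card (SimpleGraph.fromEdgeSet (S : Set (Sym2 V))).ConnectedComponent +
      (S.filter fun e => Sep (SimpleGraph.fromEdgeSet {f | f ∈ S ∧ w f < w e}) e).card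
      = Nat.card V := by
  induction S using Finset.induction_on_max_value w with
  | empty =>
    simp only [Finset.coe_empty, SimpleGraph.fromEdgeSet_empty, Finset.filter_empty,
      Finset.card_empty, add_zero]
    symm
    refine Nat.card_eq_of_bijective (⊥ : SimpleGraph V).connectedComponentMk ⟨?_, ?_⟩
    · intro a b hab
      simpa using SimpleGraph.ConnectedComponent.exact hab
    · exact Quot.mk_surjective
  | insert e S he hmax ih =>
    have ih := ih (hinj.mono (by simp))
    have hlt : ∀ f ∈ S, w f < w e := fun f hf => lt_of_le_of_ne (hmax f hf) fun h => by
      have := hinj (by simp [hf]) (by simp) h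
      exact he (this ▸ hf)
    have hset : ∀ g ∈ S, {f | f ∈ insert e S ∧ w f < w g} = {f | f ∈ S ∧ w f < w g} := by
      intro g hg
      ext f
      simp only [Finset.mem_insert, Set.mem_ofPred_eq]
      constructor
      · rintro ⟨rfl | h, h2⟩
        · exact absurd h2 (not_lt.mpr (hlt g hg).le)
        · exact ⟨h, h2⟩
      · rintro ⟨h, h2⟩; exact ⟨Or.inr h, h2⟩
    have hsete : {f | f ∈ insert e S ∧ w f < w e} = (S : Set (Sym2 V)) := by
      ext f
      simp only [Finset.mem_insert, Set.mem_ofPred_eq, Finset.mem_coe]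
      constructor
      · rintro ⟨rfl | h, h2⟩
        · exact absurd h2 (lt_irrefl _)
        · exact h
      · intro h; exact ⟨Or.inr h, hlt f h⟩
    have hfil : (S.filter fun g => Sep (SimpleGraph.fromEdgeSet
        {f | f ∈ insert e S ∧ w f < w g}) g) =
        S.filter fun g => Sep (SimpleGraph.fromEdgeSet {f | f ∈ S ∧ w f < w g}) g := by
      apply Finset.filter_congr
      intro g hg
      rw [hset g hg]
    rw [Finset.filter_insert, hfil, hsete]
    induction e using Sym2.ind with | h u v
    have hG : SimpleGraph.fromEdgeSet ((insert s(u, v) S : Finset (Sym2 V)) : Set (Sym2 V)) =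
        SimpleGraph.fromEdgeSet (S : Set (Sym2 V)) ⊔ SimpleGraph.edge u v := by
      ext a b
      simp only [SimpleGraph.fromEdgeSet_adj, SimpleGraph.sup_adj, SimpleGraph.edge_adj,
        Finset.coe_insert, Set.mem_insert_iff, Finset.mem_coe, Sym2.eq_iff]
      grind
    rw [hG, sep_mk]
    split_ifs with hr
    · rw [card_sup_of_reachable hr]
      exact ih
    · rw [Finset.card_insert_of_notMem (by simp [he])]
      have := card_sup_of_not_reachable hr
      omega

end CompCount

/-- For `P` in general position and every `δ ≥ 0`, the number of
connected components of the `δ`-threshold graph on `P` equals `n` minus the number of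
topology-changing edges of `P` of length at most `δ`. -/
theorem component_count {d : ℕ} (P : Finset (EuclideanSpace ℝ (Fin d)))
    (hgp : GenPos P) (δ : ℝ) (hδ : 0 ≤ δ) :
    Nat.card (threshGraph P δ).ConnectedComponent =
      P.card - {e : Sym2 P | e ∈ (topoGraph P).edgeSet ∧ edgeLen P e ≤ δ}.ncard := by
  have hadj : ∀ p q : P, (threshGraph P δ).Adj p q ↔ p ≠ q ∧ edgeLen P s(p, q) ≤ δ := by
    intro p q
    simp [threshGraph, edgeLen, dist_comm]
  have hsadj : ∀ (l : ℝ) (p q : P), (strictGraph P l).Adj p q ↔ p ≠ q ∧ edgeLen P s(p, q) < l := by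
    intro l p q
    simp [strictGraph, edgeLen, dist_comm]
  have hinj : Set.InjOn (edgeLen P) ((threshGraph P δ).edgeFinset : Set (Sym2 P)) := by
    intro e he f hf hef
    induction e using Sym2.ind with | h p q
    induction f using Sym2.ind with | h r s
    rw [SimpleGraph.coe_edgeFinset, SimpleGraph.mem_edgeSet, hadj] at he hf
    exact Sym2.eq_iff.mpr (hgp p q r s he.1 hf.1 hef)
  have key := CompCount.kruskal (edgeLen P) (threshGraph P δ).edgeFinset hinj
  rw [SimpleGraph.coe_edgeFinset, SimpleGraph.fromEdgeSet_edgeSet] at key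
  have hcount : {e : Sym2 P | e ∈ (topoGraph P).edgeSet ∧ edgeLen P e ≤ δ} =
      ((threshGraph P δ).edgeFinset.filter fun e => CompCount.Sep (SimpleGraph.fromEdgeSet
        {f | f ∈ (threshGraph P δ).edgeFinset ∧ edgeLen P f < edgeLen P e}) e :
          Finset (Sym2 P)) := by
    ext e
    induction e using Sym2.ind with | h p q
    rw [Finset.mem_coe, Finset.mem_filter, CompCount.sep_mk, SimpleGraph.mem_edgeFinset,
      SimpleGraph.mem_edgeSet, hadj, Set.mem_ofPred_eq, SimpleGraph.mem_edgeSet]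
    have htopo : (topoGraph P).Adj p q ↔
        p ≠ q ∧ ¬ (strictGraph P (edgeLen P s(p, q))).Reachable p q := by
      have h1 : edgeLen P s(p, q) = dist (p : EuclideanSpace ℝ (Fin d)) q := rfl
      rw [h1, topoGraph, SimpleGraph.fromRel_adj, IsTopoEdge, IsTopoEdge,
        dist_comm (q : EuclideanSpace ℝ (Fin d)) p, SimpleGraph.reachable_comm (u := q)]
      tauto
    rw [htopo]
    have hgr : edgeLen P s(p, q) ≤ δ → SimpleGraph.fromEdgeSet
        {f | f ∈ (threshGraph P δ).edgeFinset ∧ edgeLen P f < edgeLen P s(p, q)} =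
        strictGraph P (edgeLen P s(p, q)) := by
      intro hle
      ext a b
      rw [SimpleGraph.fromEdgeSet_adj, Set.mem_ofPred_eq, SimpleGraph.mem_edgeFinset,
        SimpleGraph.mem_edgeSet, hadj, hsadj]
      constructor
      · rintro ⟨⟨_, h⟩, hne⟩; exact ⟨hne, h⟩
      · rintro ⟨hne, h⟩; exact ⟨⟨⟨hne, h.le.trans hle⟩, h⟩, hne⟩
    constructor
    · rintro ⟨⟨hne, h⟩, hle⟩
      rw [hgr hle]; exact ⟨⟨hne, hle⟩, h⟩
    · rintro ⟨⟨hne, hle⟩, h⟩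
      rw [hgr hle] at h; exact ⟨⟨hne, h⟩, hle⟩
  rw [hcount, Set.ncard_coe_finset]
  have hP : Nat.card P = P.card := by simp
  omega
end

section
/- Let P be a finite set of n points in Euclidean space ℝ^d that is in general position. Then there exists an injective map f : P → ℝ² such that: (i) for every δ ≥ 0 and all p, q ∈ P, the points p and q lie in the same connected component of the δ-threshold graph on P if and only if f(p) and f(q) lie in the same connected component of the δ-threshold graph on the image f(P) ⊂ ℝ²; and (ii) the image f(P) has exactly n − 1 topology-changing edges, and the lengths of the topology-changing edges of f(P), listed in increasing order, are equal to the lengths of the topology-changing edges of P, listed in increasing order. -/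
open scoped Classical

/-- Data of a Prim-type ordering. -/
structure PrimData {X : Type*} [MetricSpace X] (P : Finset X) (n : ℕ) (q : ℕ → P)
    (w : ℕ → ℝ) (par : ℕ → ℕ) : Prop where
  inj : ∀ i j, i < n → j < n → q i = q j → i = j
  surj : ∀ p : P, ∃ i, i < n ∧ q i = p
  cut : ∀ i m j, i < m → m ≤ j → j < n → w m ≤ dist (q i : X) (q j : X)
  par_lt : ∀ m, 0 < m → m < n → par m < m
  par_dist : ∀ m, 0 < m → m < n → dist (q (par m) : X) (q m : X) = w m
  uniq : ∀ i m j, i < m → m ≤ j → j < n → dist (q i : X) (q j : X) = w m → i = par m ∧ j = m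

theorem threshGraph_adj' {X : Type*} [MetricSpace X] (P : Finset X) (δ : ℝ) (p q : P) :
    (threshGraph P δ).Adj p q ↔ p ≠ q ∧ dist (p : X) (q : X) ≤ δ := by
  simp [threshGraph, SimpleGraph.fromRel_adj, dist_comm (q : X) (p : X)]

theorem strictGraph_adj' {X : Type*} [MetricSpace X] (P : Finset X) (δ : ℝ) (p q : P) :
    (strictGraph P δ).Adj p q ↔ p ≠ q ∧ dist (p : X) (q : X) < δ := by
  simp [strictGraph, SimpleGraph.fromRel_adj, dist_comm (q : X) (p : X)]

theorem topoEdge_symm {X : Type*} [MetricSpace X] (P : Finset X) (p q : P)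
    (h : IsTopoEdge P p q) : IsTopoEdge P q p := by
  refine ⟨h.1.symm, fun hr => h.2 ?_⟩
  rw [dist_comm]
  exact hr.symm

theorem topoGraph_adj' {X : Type*} [MetricSpace X] (P : Finset X) (p q : P) :
    (topoGraph P).Adj p q ↔ IsTopoEdge P p q := by
  simp only [topoGraph, SimpleGraph.fromRel_adj]
  constructor
  · rintro ⟨_, h | h⟩
    · exact h
    · exact topoEdge_symm P _ _ h
  · intro h
    exact ⟨h.1, Or.inl h⟩

namespace PrimData

variable {X : Type*} [MetricSpace X] {P : Finset X} {n : ℕ} {q : ℕ → P}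
    {w : ℕ → ℝ} {par : ℕ → ℕ}

theorem reach_of {G : SimpleGraph P} (T : ℝ → Prop)
    (hT : ∀ a b : ℝ, a ≤ b → T b → T a)
    (hG : ∀ p q, G.Adj p q ↔ p ≠ q ∧ T (dist (p : X) (q : X)))
    (D : PrimData P n q w par) (j : ℕ) : j < n → ∀ i ≤ j,
    (∀ m, i < m → m ≤ j → T (w m)) → G.Reachable (q i) (q j) := by
  induction j using Nat.strong_induction_on with
  | _ j ih =>
  intro hj i hij h
  rcases hij.eq_or_lt with rfl | hij
  · exact SimpleGraph.Reachable.refl _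
  have hj0 : 0 < j := by omega
  have hp := D.par_lt j hj0 hj
  have hd := D.par_dist j hj0 hj
  have hTj := h j hij le_rfl
  have h1 : G.Reachable (q (par j)) (q j) := by
    apply SimpleGraph.Adj.reachable
    rw [hG, hd]
    exact ⟨fun he => by have := D.inj _ _ (by omega) hj he; omega, hTj⟩
  have h2 : G.Reachable (q (par j)) (q (j - 1)) := by
    apply ih (j - 1) (by omega) (by omega) _ (by omega)
    intro m hm1 hm2
    refine hT _ _ ?_ hTj
    rw [← hd]
    exact D.cut _ _ _ hm1 (by omega) hj
  have h3 : G.Reachable (q i) (q (j - 1)) := by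
    apply ih (j - 1) (by omega) (by omega) _ (by omega)
    intro m hm1 hm2
    exact h m hm1 (by omega)
  exact h3.trans (h2.symm.trans h1)

theorem of_reach {G : SimpleGraph P} (T : ℝ → Prop)
    (hT : ∀ a b : ℝ, a ≤ b → T b → T a)
    (hG : ∀ p q, G.Adj p q ↔ p ≠ q ∧ T (dist (p : X) (q : X)))
    (D : PrimData P n q w par) (i j : ℕ) (hj : j < n)
    (h : G.Reachable (q i) (q j)) (m : ℕ) (him : i < m) (hmj : m ≤ j) : T (w m) := by
  by_contra hn
  have key : ∀ a b : P, G.Reachable a b → (∃ k, k < m ∧ q k = a) → ∃ k, k < m ∧ q k = b := by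
    intro a b hab
    obtain ⟨W⟩ := hab
    induction W with
    | nil => exact id
    | cons hadj _ ih =>
      rename_i v _ _
      rintro ⟨k, hk, rfl⟩
      apply ih
      obtain ⟨l, hl, rfl⟩ := D.surj v
      refine ⟨l, ?_, rfl⟩
      by_contra hlm
      exact hn (hT _ _ (D.cut k m l hk (by omega) hl) ((hG _ _).1 hadj).2)
  obtain ⟨k, hk, he⟩ := key _ _ h ⟨i, him, rfl⟩
  have := D.inj _ _ (by omega) hj he
  omega

theorem thresh_iff (D : PrimData P n q w par) (δ : ℝ) (i j : ℕ) (hij : i ≤ j) (hj : j < n) :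
    (threshGraph P δ).Reachable (q i) (q j) ↔ ∀ m, i < m → m ≤ j → w m ≤ δ := by
  have hT : ∀ a b : ℝ, a ≤ b → (fun x => x ≤ δ) b → (fun x => x ≤ δ) a :=
    fun a b h1 h2 => le_trans h1 h2
  exact ⟨fun h m => of_reach (fun x => x ≤ δ) hT (threshGraph_adj' P δ) D i j hj h m,
    reach_of (fun x => x ≤ δ) hT (threshGraph_adj' P δ) D j hj i hij⟩

theorem strict_iff (D : PrimData P n q w par) (δ : ℝ) (i j : ℕ) (hij : i ≤ j) (hj : j < n) :
    (strictGraph P δ).Reachable (q i) (q j) ↔ ∀ m, i < m → m ≤ j → w m < δ := by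
  have hT : ∀ a b : ℝ, a ≤ b → (fun x => x < δ) b → (fun x => x < δ) a :=
    fun a b h1 h2 => lt_of_le_of_lt h1 h2
  exact ⟨fun h m => of_reach (fun x => x < δ) hT (strictGraph_adj' P δ) D i j hj h m,
    reach_of (fun x => x < δ) hT (strictGraph_adj' P δ) D j hj i hij⟩

theorem topo_iff (D : PrimData P n q w par) (i j : ℕ) (hij : i < j) (hj : j < n) :
    (topoGraph P).Adj (q i) (q j) ↔ i = par j := by
  rw [topoGraph_adj', IsTopoEdge, D.strict_iff _ i j hij.le hj]
  constructor
  · rintro ⟨_, h⟩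
    push Not at h
    obtain ⟨m, h1, h2, h3⟩ := h
    have := D.uniq i m j h1 h2 hj (le_antisymm h3 (D.cut i m j h1 h2 hj))
    rw [this.2]
    exact this.1
  · intro h
    refine ⟨fun he => ?_, fun hr => ?_⟩
    · have := D.inj _ _ (by omega) hj he
      omega
    · have h1 := hr j hij le_rfl
      have h2 := D.par_dist j (by omega) hj
      rw [← h] at h2
      exact absurd h1 (by rw [h2]; exact lt_irrefl _)

theorem edges (D : PrimData P n q w par) :
    ∃ E : Fin (n - 1) ≃ (topoGraph P).edgeSet,
      ∀ m, edgeLen P (E m : Sym2 P) = w (m + 1) := by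
  have hmem : ∀ m : Fin (n - 1),
      s(q (par (m + 1)), q (m + 1)) ∈ (topoGraph P).edgeSet := by
    intro m
    have hm := m.2
    rw [SimpleGraph.mem_edgeSet]
    exact (D.topo_iff _ _ (D.par_lt _ (by omega) (by omega)) (by omega)).2 rfl
  let F : Fin (n - 1) → (topoGraph P).edgeSet := fun m => ⟨_, hmem m⟩
  have hF : Function.Bijective F := by
    constructor
    · intro a b hab
      have ha := a.2
      have hb := b.2
      have h1 := D.par_lt (a + 1) (by omega) (by omega)
      have h2 := D.par_lt (b + 1) (by omega) (by omega)
      have h := congrArg Subtype.val hab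
      simp only [F, Sym2.eq_iff] at h
      rcases h with ⟨_, h⟩ | ⟨h, h'⟩
      · have := D.inj _ _ (by omega) (by omega) h
        ext; omega
      · have := D.inj _ _ (by omega) (by omega) h
        have := D.inj _ _ (by omega) (by omega) h'
        omega
    · rintro ⟨e, he⟩
      have main : ∀ i j, i < j → j < n → (topoGraph P).Adj (q i) (q j) →
          ∃ a, (F a : Sym2 P) = s(q i, q j) := by
        intro i j hij hj hadj
        have := (D.topo_iff i j hij hj).1 hadj
        refine ⟨⟨j - 1, by omega⟩, ?_⟩
        have hj1 : j - 1 + 1 = j := by omega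
        simp only [F, hj1, this]
      induction e using Sym2.ind with
      | _ x y =>
      obtain ⟨i, hi, rfl⟩ := D.surj x
      obtain ⟨j, hj, rfl⟩ := D.surj y
      rw [SimpleGraph.mem_edgeSet] at he
      rcases lt_trichotomy i j with h | h | h
      · obtain ⟨a, ha⟩ := main i j h hj he
        exact ⟨a, Subtype.ext ha⟩
      · subst h
        exact absurd rfl he.ne
      · obtain ⟨a, ha⟩ := main j i h hi he.symm
        exact ⟨a, Subtype.ext (ha.trans Sym2.eq_swap)⟩
  refine ⟨Equiv.ofBijective F hF, fun m => ?_⟩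
  have hm := m.2
  exact D.par_dist (m + 1) (by omega) (by omega)

end PrimData

theorem exists_nearest {X : Type*} [MetricSpace X] (P : Finset X) [hP : Nonempty P]
    (S : Finset P) :
    ∃ c : P, S.Nonempty → S ≠ Finset.univ →
      c ∉ S ∧ ∃ s ∈ S, ∀ s' ∈ S, ∀ y, y ∉ S → dist (s : X) (c : X) ≤ dist (s' : X) (y : X) := by
  by_cases h : S.Nonempty ∧ S ≠ Finset.univ
  · obtain ⟨h1, h2⟩ := h
    have h3 : (Sᶜ).Nonempty := by
      rw [Finset.nonempty_iff_ne_empty]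
      simpa using h2
    obtain ⟨⟨s, c⟩, hm, hmin⟩ := Finset.exists_min_image (S ×ˢ Sᶜ)
      (fun z => dist (z.1 : X) (z.2 : X)) (h1.product h3)
    rw [Finset.mem_product] at hm
    refine ⟨c, fun _ _ => ⟨by simpa using hm.2, s, hm.1, fun s' hs' y hy => ?_⟩⟩
    exact hmin (s', y) (by simp [hs', hy])
  · exact ⟨hP.some, fun h1 h2 => absurd ⟨h1, h2⟩ h⟩

theorem exists_prim {X : Type*} [MetricSpace X] (P : Finset X) (hgp : GenPos P)
    (hP : P.Nonempty) :
    ∃ (q : ℕ → P) (w : ℕ → ℝ) (par : ℕ → ℕ), PrimData P P.card q w par ∧ ∀ m, 0 < w m := by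
  have hne : Nonempty P := hP.to_subtype
  choose c hc using exists_nearest P
  let p0 : P := hne.some
  let S : ℕ → Finset P := fun k => Nat.rec {p0} (fun _ T => insert (c T) T) k
  have S0 : S 0 = {p0} := rfl
  have S1 : ∀ k, S (k + 1) = insert (c (S k)) (S k) := fun k => rfl
  let q : ℕ → P := fun k => Nat.casesOn k p0 (fun k => c (S k))
  have q0 : q 0 = p0 := rfl
  have q1 : ∀ k, q (k + 1) = c (S k) := fun k => rfl
  have hS : ∀ k, S k = (Finset.range (k + 1)).image q := by
    intro k
    induction k with
    | zero => simp [S0, q0]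
    | succ k ih =>
      rw [S1, ← q1, Finset.range_add_one, Finset.image_insert, ← ih]
  have hSne : ∀ k, (S k).Nonempty := by
    intro k
    rw [hS]
    simp
  have hSu : ∀ k, k + 1 < P.card → S k ≠ Finset.univ := by
    intro k hk he
    have h1 : (S k).card ≤ k + 1 := by
      rw [hS]
      exact Finset.card_image_le.trans (by simp)
    rw [he, Finset.card_univ, Fintype.card_coe] at h1
    omega
  have hinj' : ∀ i j, i < j → j < P.card → q i ≠ q j := by
    intro i j hij hj he
    obtain ⟨k, rfl⟩ : ∃ k, j = k + 1 := ⟨j - 1, by omega⟩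
    have := (hc (S k) (hSne k) (hSu k hj)).1
    apply this
    rw [← q1, ← he, hS]
    exact Finset.mem_image_of_mem q (by simp; omega)
  have hinj : ∀ i j, i < P.card → j < P.card → q i = q j → i = j := by
    intro i j hi hj he
    rcases lt_trichotomy i j with h | h | h
    · exact absurd he (hinj' i j h hj)
    · exact h
    · exact absurd he.symm (hinj' j i h hi)
  have hsurj : ∀ p : P, ∃ i, i < P.card ∧ q i = p := by
    have : (Finset.range P.card).image q = Finset.univ := by
      apply Finset.eq_univ_of_card
      rw [Finset.card_image_of_injOn, Finset.card_range, Fintype.card_coe]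
      intro i hi j hj he
      exact hinj i j (by simpa using hi) (by simpa using hj) he
    intro p
    have hp : p ∈ (Finset.range P.card).image q := by rw [this]; simp
    obtain ⟨i, hi, he⟩ := Finset.mem_image.1 hp
    exact ⟨i, Finset.mem_range.1 hi, he⟩
  have hpar : ∀ m : ℕ, ∃ i : ℕ, 0 < m → m < P.card → i < m ∧
      ∀ i' j : ℕ, i' < m → m ≤ j → j < P.card →
        dist (q i).1 (q m).1 ≤ dist (q i').1 (q j).1 := by
    intro m
    by_cases hm : 0 < m ∧ m < P.card
    · obtain ⟨k, rfl⟩ : ∃ k, m = k + 1 := ⟨m - 1, by omega⟩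
      obtain ⟨_, s, hs, hmin⟩ := hc (S k) (hSne k) (hSu k hm.2)
      rw [hS, Finset.mem_image] at hs
      obtain ⟨i, hi, rfl⟩ := hs
      refine ⟨i, fun _ _ => ⟨by simpa using hi, fun i' j hi' hj hjn => ?_⟩⟩
      rw [q1]
      refine hmin (q i') ?_ (q j) ?_
      · rw [hS]
        exact Finset.mem_image_of_mem q (by simpa using hi')
      · rw [hS, Finset.mem_image]
        rintro ⟨l, hl, he⟩
        have hl' : l < k + 1 := by simpa using hl
        exact hinj' l j (by omega) hjn he
    · exact ⟨0, fun h1 h2 => absurd ⟨h1, h2⟩ hm⟩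
  choose par hpar using hpar
  have hdpos : ∀ m, 0 < m → m < P.card → 0 < dist (q (par m)).1 (q m).1 := by
    intro m h0 hm
    rw [dist_pos]
    intro he
    exact hinj' _ _ (hpar m h0 hm).1 hm (Subtype.ext he)
  let w : ℕ → ℝ := fun m =>
    if 0 < dist (q (par m)).1 (q m).1 then dist (q (par m)).1 (q m).1 else 1
  have hw : ∀ m, 0 < m → m < P.card → w m = dist (q (par m)).1 (q m).1 := by
    intro m h0 hm
    exact if_pos (hdpos m h0 hm)
  refine ⟨q, w, par, ⟨hinj, hsurj, ?_, ?_, ?_, ?_⟩, ?_⟩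
  · intro i m j him hmj hj
    rw [hw m (by omega) (by omega)]
    exact (hpar m (by omega) (by omega)).2 i j him hmj hj
  · intro m h0 hm
    exact (hpar m h0 hm).1
  · intro m h0 hm
    exact (hw m h0 hm).symm
  · intro i m j him hmj hj hd
    have hp := (hpar m (by omega) (by omega)).1
    rw [hw m (by omega) (by omega)] at hd
    rcases hgp _ _ _ _ (hinj' i j (by omega) hj) (hinj' _ m hp (by omega)) hd with
      ⟨h1, h2⟩ | ⟨h1, h2⟩
    · exact ⟨hinj _ _ (by omega) (by omega) h1, hinj _ _ (by omega) (by omega) h2⟩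
    · have := hinj _ _ (by omega) (by omega) h1
      omega
  · intro m
    simp only [w]
    split_ifs with h
    · exact h
    · exact one_pos

/-- **Proposition 1, parts (a) and (b).** For `P` of `n` points in
`ℝ^d` in general position, there is an injective map `f : P → ℝ²` such that:
(i) for every `δ ≥ 0`, two points of `P` lie in the same connected component of the
`δ`-threshold graph on `P` iff their images do in the `δ`-threshold graph on `f(P)`;
(ii) `f(P)` has exactly `n - 1` topology-changing edges and there is a
length-preserving bijection between the topology-changing edges of `P` and those of
`f(P)` (so their length lists in increasing order coincide). -/
theorem topomap_exists_2d {d : ℕ} (P : Finset (EuclideanSpace ℝ (Fin d)))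
    (hgp : GenPos P) :
    ∃ f : EuclideanSpace ℝ (Fin d) → EuclideanSpace ℝ (Fin 2),
      Set.InjOn f ↑P ∧
      (∀ δ : ℝ, 0 ≤ δ → ∀ p q : P,
        (threshGraph P δ).Reachable p q ↔
        (threshGraph (P.image f) δ).Reachable
          ⟨f p, Finset.mem_image_of_mem f p.2⟩
          ⟨f q, Finset.mem_image_of_mem f q.2⟩) ∧
      (topoGraph (P.image f)).edgeSet.ncard = P.card - 1 ∧
      ∃ g : (topoGraph P).edgeSet ≃ (topoGraph (P.image f)).edgeSet,
        ∀ e : (topoGraph P).edgeSet,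
          edgeLen (P.image f) (g e : Sym2 (P.image f)) = edgeLen P (e : Sym2 P) := by
  rcases P.eq_empty_or_nonempty with rfl | hP
  · refine ⟨fun _ => 0, by simp, fun δ _ p => absurd p.2 (Finset.notMem_empty _), ?_, ?_⟩
    · have : (topoGraph ((∅ : Finset (EuclideanSpace ℝ (Fin d))).image
          (fun _ => (0 : EuclideanSpace ℝ (Fin 2))))).edgeSet = ∅ := by
        ext e
        induction e using Sym2.ind with
        | _ x y => exact absurd x.2 (by simp)
      rw [this, Set.ncard_empty, Finset.card_empty]
    · have h1 : IsEmpty (topoGraph (∅ : Finset (EuclideanSpace ℝ (Fin d)))).edgeSet := by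
        constructor
        rintro ⟨e, he⟩
        induction e using Sym2.ind with
        | _ x y => exact absurd x.2 (Finset.notMem_empty _)
      have h2 : IsEmpty (topoGraph ((∅ : Finset (EuclideanSpace ℝ (Fin d))).image
          (fun _ => (0 : EuclideanSpace ℝ (Fin 2))))).edgeSet := by
        constructor
        rintro ⟨e, he⟩
        induction e using Sym2.ind with
        | _ x y => exact absurd x.2 (by simp)
      exact ⟨Equiv.equivOfIsEmpty _ _, fun e => h1.elim e⟩
  obtain ⟨q, w, par, D, hw⟩ := exists_prim P hgp hP
  let x : ℕ → ℝ := fun k => ∑ m ∈ Finset.range k, w (m + 1)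
  have x1 : ∀ k, x (k + 1) = x k + w (k + 1) := fun k => Finset.sum_range_succ _ _
  have hx : StrictMono x := strictMono_nat_of_lt_succ fun k => by
    rw [x1]
    linarith [hw (k + 1)]
  choose idx hidx1 hidx2 using D.surj
  let f : EuclideanSpace ℝ (Fin d) → EuclideanSpace ℝ (Fin 2) := fun z =>
    if h : z ∈ P then EuclideanSpace.single 0 (x (idx ⟨z, h⟩)) else 0
  have hf : ∀ p : P, f p = EuclideanSpace.single 0 (x (idx p)) := fun p => dif_pos p.2
  have hfq : ∀ k, k < P.card → f (q k) = EuclideanSpace.single 0 (x k) := by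
    intro k hk
    rw [hf, D.inj _ _ (hidx1 _) hk (hidx2 (q k))]
  have hdist : ∀ i j, i < j → j < P.card → dist (f (q i)) (f (q j)) = x j - x i := by
    intro i j hij hj
    rw [hfq i (by omega), hfq j hj, PiLp.dist_single_same, dist_comm, Real.dist_eq,
      abs_of_pos (sub_pos.2 (hx hij))]
  have hfinj : Set.InjOn f ↑P := by
    intro a ha b hb hab
    obtain ⟨i, hi, hia⟩ := D.surj ⟨a, ha⟩
    obtain ⟨j, hj, hjb⟩ := D.surj ⟨b, hb⟩
    have ha' : a = q i := by rw [hia]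
    have hb' : b = q j := by rw [hjb]
    rw [ha', hb', hfq i hi, hfq j hj] at hab
    have h0 := dist_self (EuclideanSpace.single (0 : Fin 2) (x i))
    nth_rewrite 2 [hab] at h0
    rw [PiLp.dist_single_same, dist_eq_zero] at h0
    rw [ha', hb', hx.injective h0]
  let q' : ℕ → (P.image f) := fun k => ⟨f (q k), Finset.mem_image_of_mem f (q k).2⟩
  have D' : PrimData (P.image f) P.card q' w (fun m => m - 1) := by
    refine ⟨?_, ?_, ?_, ?_, ?_, ?_⟩
    · intro i j hi hj he
      have h := congrArg Subtype.val he
      exact D.inj i j hi hj (Subtype.ext (hfinj (q i).2 (q j).2 h))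
    · rintro ⟨p, hp⟩
      obtain ⟨a, ha, rfl⟩ := Finset.mem_image.1 hp
      obtain ⟨i, hi, hia⟩ := D.surj ⟨a, ha⟩
      refine ⟨i, hi, Subtype.ext ?_⟩
      simp only [q', hia]
    · intro i m j him hmj hj
      obtain ⟨k, rfl⟩ : ∃ k, m = k + 1 := ⟨m - 1, by omega⟩
      simp only [q']
      rw [hdist i j (by omega) hj]
      have h1 := hx.monotone (show i ≤ k by omega)
      have h2 := hx.monotone hmj
      linarith [x1 k]
    · intro m h0 _
      exact Nat.sub_lt h0 one_pos
    · intro m h0 hm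
      obtain ⟨k, rfl⟩ : ∃ k, m = k + 1 := ⟨m - 1, by omega⟩
      simp only [q', Nat.add_sub_cancel]
      rw [hdist k (k + 1) (by omega) hm]
      linarith [x1 k]
    · intro i m j him hmj hj hd
      obtain ⟨k, rfl⟩ : ∃ k, m = k + 1 := ⟨m - 1, by omega⟩
      simp only [q'] at hd
      rw [hdist i j (by omega) hj] at hd
      have h1 := hx.monotone (show i ≤ k by omega)
      have h2 := hx.monotone hmj
      have h3 : x i = x k := by linarith [x1 k]
      have h4 : x j = x (k + 1) := by linarith [x1 k]
      exact ⟨by simpa using hx.injective h3, hx.injective h4⟩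
  obtain ⟨E, hE⟩ := D.edges
  obtain ⟨E', hE'⟩ := D'.edges
  refine ⟨f, hfinj, ?_, ?_, E.symm.trans E', ?_⟩
  · intro δ _ a b
    obtain ⟨i, hi, rfl⟩ := D.surj a
    obtain ⟨j, hj, rfl⟩ := D.surj b
    change _ ↔ (threshGraph (P.image f) δ).Reachable (q' i) (q' j)
    rcases le_total i j with h | h
    · rw [D.thresh_iff δ i j h hj, D'.thresh_iff δ i j h hj]
    · rw [SimpleGraph.reachable_comm, D.thresh_iff δ j i h hi, SimpleGraph.reachable_comm,
        D'.thresh_iff δ j i h hi]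
  · rw [← Nat.card_coe_set_eq, ← Nat.card_congr E', Nat.card_fin]
  · intro e
    rw [Equiv.trans_apply, hE', ← hE, Equiv.apply_symm_apply]
end

section
/- Let P₁ and P₂ be disjoint nonempty finite subsets of Euclidean space ℝ^d, let d* be the minimum of dist(p,q) over p ∈ P₁ and q ∈ P₂, and suppose that P₁ is connected in the simple graph on P₁ whose edges are pairs at distance < d*, and likewise for P₂. Let f : P₁ ∪ P₂ → ℝ² be an injective map such that: (i) for every δ ≥ 0 and all p, q ∈ P₁, p and q are in the same connected component of the δ-threshold graph on P₁ if and only if f(p) and f(q) are in the same connected component of the δ-threshold graph on f(P₁), and the same holds for P₂; (ii) dist(f(p), f(q)) ≥ d* for all p ∈ P₁ and q ∈ P₂; and (iii) the minimum of dist(f(p), f(q)) over p ∈ P₁ and q ∈ P₂ equals d*. Then for every δ ≥ 0 and all p, q ∈ P₁ ∪ P₂, p and q are in the same connected component of the δ-threshold graph on P₁ ∪ P₂ if and only if f(p) and f(q) are in the same connected component of the δ-threshold graph on f(P₁ ∪ P₂). -/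
open scoped Classical

/-- Chains in `S` with steps of length at most `δ`. -/
def StepChain {X : Type*} [MetricSpace X] (S : Set X) (δ : ℝ) : X → X → Prop :=
  Relation.ReflTransGen (fun a b => a ∈ S ∧ b ∈ S ∧ dist a b ≤ δ)

theorem reachable_iff_chain {X : Type*} [MetricSpace X] (P : Finset X) (δ : ℝ) (p q : P) :
    (threshGraph P δ).Reachable p q ↔ StepChain (P : Set X) δ p q := by
  constructor
  · intro h
    rw [SimpleGraph.reachable_iff_reflTransGen] at h
    refine Relation.ReflTransGen.lift (fun x : P => (x : X)) ?_ _ _ h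
    intro a b hab
    refine ⟨a.2, b.2, ?_⟩
    rcases hab with ⟨_, h | h⟩
    · exact h
    · rw [dist_comm]; exact h
  · intro h
    have key : ∀ x y : X, StepChain (P : Set X) δ x y → ∀ hx : x ∈ P, ∃ hy : y ∈ P,
        (threshGraph P δ).Reachable ⟨x, hx⟩ ⟨y, hy⟩ := by
      intro x y hxy hx
      induction hxy with
      | refl => exact ⟨hx, SimpleGraph.Reachable.refl _⟩
      | @tail b c _ hbc ih =>
        obtain ⟨hb, hr⟩ := ih
        refine ⟨hbc.2.1, hr.trans ?_⟩
        by_cases e : b = c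
        · subst e; exact SimpleGraph.Reachable.refl _
        · apply SimpleGraph.Adj.reachable
          exact ⟨fun h => e (congrArg Subtype.val h), Or.inl hbc.2.2⟩
    obtain ⟨_, h⟩ := key _ _ h p.2
    exact h

theorem StepChain.mono {X : Type*} [MetricSpace X] {S T : Set X} {δ : ℝ} (h : S ⊆ T) {x y : X}
    (hx : StepChain S δ x y) : StepChain T δ x y :=
  Relation.ReflTransGen.mono (fun _ _ hab => ⟨h hab.1, h hab.2.1, hab.2.2⟩) _ _ hx

theorem StepChain.restrict {X : Type*} [MetricSpace X] {A B : Set X} {δ : ℝ}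
    (hAB : ∀ a ∈ A, ∀ b ∈ B, δ < dist a b) {x y : X} (hx : x ∈ A)
    (h : StepChain (A ∪ B) δ x y) : y ∈ A ∧ StepChain A δ x y := by
  induction h with
  | refl => exact ⟨hx, Relation.ReflTransGen.refl⟩
  | @tail b c _ hbc ih =>
    have hc : c ∈ A := by
      rcases hbc.2.1 with hc | hc
      · exact hc
      · exact absurd hbc.2.2 (not_le.mpr (hAB _ ih.1 _ hc))
    exact ⟨hc, ih.2.tail ⟨ih.1, hc, hbc.2.2⟩⟩

theorem low_case {X Y : Type*} [MetricSpace X] [MetricSpace Y] {A B : Set X} {δ : ℝ}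
    (hδ : 0 ≤ δ) (f : X → Y) (hAB : ∀ a ∈ A, ∀ b ∈ B, δ < dist a b)
    (hf : ∀ a ∈ A, ∀ b ∈ B, δ < dist (f a) (f b))
    (hi : ∀ p ∈ A, ∀ q ∈ A, StepChain A δ p q ↔ StepChain (f '' A) δ (f p) (f q))
    {p q : X} (hp : p ∈ A) (hq : q ∈ A ∪ B) :
    StepChain (A ∪ B) δ p q ↔ StepChain (f '' A ∪ f '' B) δ (f p) (f q) := by
  constructor
  · intro h
    obtain ⟨hqA, h⟩ := h.restrict hAB hp
    exact ((hi p hp q hqA).1 h).mono Set.subset_union_left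
  · intro h
    obtain ⟨⟨r, hr, hrq⟩, h⟩ := h.restrict
      (by rintro _ ⟨a, ha, rfl⟩ _ ⟨b, hb, rfl⟩; exact hf a ha b hb) (Set.mem_image_of_mem f hp)
    rcases hq with hq | hq
    · exact ((hi p hp q hq).2 h).mono Set.subset_union_left
    · have := hf r hr q hq
      rw [hrq, dist_self] at this
      linarith

theorem high_case {X : Type*} [MetricSpace X] {A B : Set X} {δ : ℝ}
    (hA : ∀ p ∈ A, ∀ q ∈ A, StepChain A δ p q) (hB : ∀ p ∈ B, ∀ q ∈ B, StepChain B δ p q)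
    (hc : ∃ a ∈ A, ∃ b ∈ B, dist a b ≤ δ) {p q : X} (hp : p ∈ A ∪ B) (hq : q ∈ A ∪ B) :
    StepChain (A ∪ B) δ p q := by
  obtain ⟨a, ha, b, hb, hab⟩ := hc
  have e1 : StepChain (A ∪ B) δ a b := Relation.ReflTransGen.single ⟨Or.inl ha, Or.inr hb, hab⟩
  have e2 : StepChain (A ∪ B) δ b a :=
    Relation.ReflTransGen.single ⟨Or.inr hb, Or.inl ha, by rwa [dist_comm]⟩
  have mA : ∀ p ∈ A, ∀ q ∈ A, StepChain (A ∪ B) δ p q :=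
    fun p hp q hq => (hA p hp q hq).mono Set.subset_union_left
  have mB : ∀ p ∈ B, ∀ q ∈ B, StepChain (A ∪ B) δ p q :=
    fun p hp q hq => (hB p hp q hq).mono Set.subset_union_right
  rcases hp with hp | hp <;> rcases hq with hq | hq
  · exact mA p hp q hq
  · exact ((mA p hp a ha).trans e1).trans (mB b hb q hq)
  · exact ((mB p hp b hb).trans e2).trans (mA a ha q hq)
  · exact mB p hp q hq

theorem strict_chain {X : Type*} [MetricSpace X] {P : Finset X} {l δ : ℝ} (h : l ≤ δ)
    (hc : (strictGraph P l).Connected) : ∀ p ∈ (P : Set X), ∀ q ∈ (P : Set X),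
      StepChain (P : Set X) δ p q := by
  intro p hp q hq
  refine (reachable_iff_chain P δ ⟨p, hp⟩ ⟨q, hq⟩).1 ((hc.preconnected ⟨p, hp⟩ ⟨q, hq⟩).mono ?_)
  rintro a b ⟨hne, hab⟩
  exact ⟨hne, hab.imp (fun t => (lt_of_lt_of_le t h).le) (fun t => (lt_of_lt_of_le t h).le)⟩

/-- **inductive merge step of Proposition 1.** Let `P₁, P₂` be
disjoint nonempty finite subsets of `ℝ^d`, `d*` the minimum cross distance, with
each `Pᵢ` connected in its strict `d*`-graph. If `f` is injective on `P₁ ∪ P₂`,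
preserves the threshold-graph components of `P₁` and of `P₂` at every `δ ≥ 0`, and
places the images of `P₁` and `P₂` at all cross distances `≥ d*` with minimum cross
distance exactly `d*`, then `f` preserves the threshold-graph components of
`P₁ ∪ P₂` at every `δ ≥ 0`. -/
theorem merge_step {d : ℕ} (P₁ P₂ : Finset (EuclideanSpace ℝ (Fin d)))
    (h1 : P₁.Nonempty) (h2 : P₂.Nonempty) (hdisj : Disjoint P₁ P₂)
    (dstar : ℝ)
    (hd : IsLeast {r : ℝ | ∃ p ∈ P₁, ∃ q ∈ P₂, r = dist p q} dstar)
    (hc1 : (strictGraph P₁ dstar).Connected)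
    (hc2 : (strictGraph P₂ dstar).Connected)
    (f : EuclideanSpace ℝ (Fin d) → EuclideanSpace ℝ (Fin 2))
    (hinj : Set.InjOn f ↑(P₁ ∪ P₂))
    (hi1 : ∀ δ : ℝ, 0 ≤ δ → ∀ p q : P₁,
      (threshGraph P₁ δ).Reachable p q ↔
      (threshGraph (P₁.image f) δ).Reachable
        ⟨f p, Finset.mem_image_of_mem f p.2⟩
        ⟨f q, Finset.mem_image_of_mem f q.2⟩)
    (hi2 : ∀ δ : ℝ, 0 ≤ δ → ∀ p q : P₂,
      (threshGraph P₂ δ).Reachable p q ↔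
      (threshGraph (P₂.image f) δ).Reachable
        ⟨f p, Finset.mem_image_of_mem f p.2⟩
        ⟨f q, Finset.mem_image_of_mem f q.2⟩)
    (hge : ∀ p ∈ P₁, ∀ q ∈ P₂, dstar ≤ dist (f p) (f q))
    (hmin : IsLeast {r : ℝ | ∃ p ∈ P₁, ∃ q ∈ P₂, r = dist (f p) (f q)} dstar) :
    ∀ δ : ℝ, 0 ≤ δ → ∀ p q : ↥(P₁ ∪ P₂),
      (threshGraph (P₁ ∪ P₂) δ).Reachable p q ↔
      (threshGraph ((P₁ ∪ P₂).image f) δ).Reachable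
        ⟨f p, Finset.mem_image_of_mem f p.2⟩
        ⟨f q, Finset.mem_image_of_mem f q.2⟩ := by
  intro δ hδ p q
  have k1 : ∀ p ∈ (P₁ : Set _), ∀ q ∈ (P₁ : Set _),
      StepChain (P₁ : Set _) δ p q ↔ StepChain (f '' (P₁ : Set _)) δ (f p) (f q) := by
    intro p hp q hq
    have := hi1 δ hδ ⟨p, hp⟩ ⟨q, hq⟩
    rwa [reachable_iff_chain, reachable_iff_chain, Finset.coe_image] at this
  have k2 : ∀ p ∈ (P₂ : Set _), ∀ q ∈ (P₂ : Set _),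
      StepChain (P₂ : Set _) δ p q ↔ StepChain (f '' (P₂ : Set _)) δ (f p) (f q) := by
    intro p hp q hq
    have := hi2 δ hδ ⟨p, hp⟩ ⟨q, hq⟩
    rwa [reachable_iff_chain, reachable_iff_chain, Finset.coe_image] at this
  rw [reachable_iff_chain, reachable_iff_chain, Finset.coe_image, Finset.coe_union,
    Set.image_union]
  obtain ⟨p, hp⟩ := p
  obtain ⟨q, hq⟩ := q
  replace hp : p ∈ (P₁ : Set _) ∪ (P₂ : Set _) := by simpa using hp
  replace hq : q ∈ (P₁ : Set _) ∪ (P₂ : Set _) := by simpa using hq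
  dsimp only
  rcases lt_or_ge δ dstar with hlt | hle
  · have c1 : ∀ a ∈ (P₁ : Set _), ∀ b ∈ (P₂ : Set _), δ < dist a b :=
      fun a ha b hb => lt_of_lt_of_le hlt (hd.2 ⟨a, ha, b, hb, rfl⟩)
    have c2 : ∀ a ∈ (P₁ : Set _), ∀ b ∈ (P₂ : Set _), δ < dist (f a) (f b) :=
      fun a ha b hb => lt_of_lt_of_le hlt (hge a ha b hb)
    rcases hp with hp | hp
    · exact low_case hδ f c1 c2 k1 hp hq
    · rw [Set.union_comm, Set.union_comm (f '' _)]
      exact low_case hδ f (fun a ha b hb => by rw [dist_comm]; exact c1 b hb a ha)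
        (fun a ha b hb => by rw [dist_comm]; exact c2 b hb a ha) k2 hp hq.symm
  · have s1 := strict_chain hle hc1
    have s2 := strict_chain hle hc2
    obtain ⟨a, ha, b, hb, hab⟩ := hd.1
    obtain ⟨a', ha', b', hb', hab'⟩ := hmin.1
    refine iff_of_true (high_case s1 s2 ⟨a, ha, b, hb, hab ▸ hle⟩ hp hq) ?_
    refine high_case ?_ ?_ ⟨f a', Set.mem_image_of_mem f ha', f b', Set.mem_image_of_mem f hb',
      hab' ▸ hle⟩ ?_ ?_
    · rintro _ ⟨x, hx, rfl⟩ _ ⟨y, hy, rfl⟩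
      exact (k1 x hx y hy).1 (s1 x hx y hy)
    · rintro _ ⟨x, hx, rfl⟩ _ ⟨y, hy, rfl⟩
      exact (k2 x hx y hy).1 (s2 x hx y hy)
    · rw [← Set.image_union]; exact Set.mem_image_of_mem f hp
    · rw [← Set.image_union]; exact Set.mem_image_of_mem f hq
end
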